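/- arXiv:2307.07028 — 2 statements merged into one kernel-verified Lean document; each statement's English description precedes it below -/
import Mathlib

section
/- Let f(z) = Σ a_n z^n be analytic on 𝔻 with (1-|z|^2)|f'(z)| ≤ 1 for all |z| < 1, and let 0 < s < 1. Then for all 0 < r < 1, Σ_{n≥1} |a_n| r^n ≤ ( r^{2(1-s)} · log(1/(1-r^{2s})) / (1 - r^{2(1-s)}) )^{1/2}. -/
open Metric Real

theorem aux_summable (a : ℕ → ℂ)
    (hf : ∀ z ∈ ball (0 : ℂ) 1, Summable (fun n : ℕ => a n * z ^ n))
    (x : ℝ) (hx0 : 0 ≤ x) (hx : x < 1) :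
    Summable (fun n : ℕ => ((n : ℝ) + 1) * ‖a (n + 1)‖ * x ^ n) := by
  obtain ⟨y, hxy, hy⟩ := exists_between hx
  have hy0 : 0 < y := lt_of_le_of_lt hx0 hxy
  have h1 := (hf (y : ℂ) (by simp [abs_of_pos hy0, hy])).norm.tendsto_atTop_zero.bddAbove_range
  obtain ⟨C, hC⟩ := h1
  have hC' : ∀ n, ‖a n‖ * y ^ n ≤ C := by
    intro n
    have := hC ⟨n, rfl⟩
    simpa [abs_of_pos hy0] using this
  have hq0 : 0 ≤ x / y := by positivity
  have hq : x / y < 1 := by rw [div_lt_one hy0]; exact hxy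
  have hs1 : Summable (fun n : ℕ => ((n : ℝ) + 1) * (x / y) ^ n) := by
    have h2 := summable_pow_mul_geometric_of_norm_lt_one 1 (r := x / y)
      (by rw [Real.norm_of_nonneg hq0]; exact hq)
    have h3 := summable_geometric_of_lt_one hq0 hq
    refine (h2.add h3).congr fun n => ?_
    simp; ring
  refine Summable.of_nonneg_of_le (fun n => by positivity) (fun n => ?_) (hs1.mul_left (C / y))
  have h4 := hC' (n + 1)
  have h5 : ‖a (n + 1)‖ ≤ C / y ^ (n + 1) := by rw [le_div_iff₀ (by positivity)]; exact h4
  calc ((n : ℝ) + 1) * ‖a (n + 1)‖ * x ^ n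
      ≤ ((n : ℝ) + 1) * (C / y ^ (n + 1)) * x ^ n := by gcongr
    _ = C / y * (((n : ℝ) + 1) * (x / y) ^ n) := by
      rw [div_pow]; field_simp; ring

theorem aux_deriv (f : ℂ → ℂ) (a : ℕ → ℂ)
    (hf : ∀ z ∈ ball (0 : ℂ) 1, HasSum (fun n : ℕ => a n * z ^ n) (f z))
    (z : ℂ) (hz : z ∈ ball (0 : ℂ) 1) :
    deriv f z = ∑' n : ℕ, ((n : ℂ) + 1) * a (n + 1) * z ^ n := by
  have hz' : ‖z‖ < 1 := by simpa using hz
  obtain ⟨x, hzx, hx⟩ := exists_between hz'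
  have hx0 : 0 < x := lt_of_le_of_lt (norm_nonneg _) hzx
  have hsum := aux_summable a (fun z hz => (hf z hz).summable) x hx0.le hx
  have key : HasDerivAt (fun w : ℂ => ∑' n : ℕ, a (n + 1) * w ^ (n + 1))
      (∑' n : ℕ, ((n : ℂ) + 1) * a (n + 1) * z ^ n) z := by
    refine hasDerivAt_tsum_of_isPreconnected (𝕜 := ℂ) (F := ℂ) (t := ball (0 : ℂ) x)
      (g := fun (n : ℕ) (w : ℂ) => a (n + 1) * w ^ (n + 1))
      (g' := fun (n : ℕ) (w : ℂ) => ((n : ℂ) + 1) * a (n + 1) * w ^ n) hsum isOpen_ball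
      (convex_ball (0 : ℂ) x).isPreconnected ?_ ?_ (y₀ := 0) (by simpa using hx0) ?_ (by simpa using hzx)
    · intro n y _
      have := (hasDerivAt_pow (n + 1) y).const_mul (a (n + 1))
      refine this.congr_deriv ?_
      push_cast
      ring
    · intro n y hy
      have hy' : ‖y‖ ≤ x := by simpa using (mem_ball_zero_iff.1 hy).le
      rw [norm_mul, norm_mul, norm_pow]
      have : ‖(n : ℂ) + 1‖ = (n : ℝ) + 1 := by
        have := Complex.norm_natCast (n + 1)
        push_cast at this; exact this
      rw [this]
      gcongr
    · simp
  have key2 := key.const_add (a 0)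
  refine HasDerivAt.deriv (key2.congr_of_eventuallyEq ?_)
  filter_upwards [isOpen_ball.mem_nhds hz] with w hw
  have h := hf w hw
  rw [← h.tsum_eq, h.summable.tsum_eq_zero_add]
  simp

instance aux_fact : Fact (0 < 2 * π) := ⟨by positivity⟩

theorem aux_part (c : ℕ → ℂ) (hc : Summable (fun n => ‖c n‖)) (M : ℝ) (u : ℂ) (hu : ‖u‖ = 1)
    (hM : ‖∑' n, c n * u ^ n‖ ≤ M) (K : ℕ) :
    ‖∑ n ∈ Finset.range K, c n * u ^ n‖ ≤ M + ∑' n, ‖c (n + K)‖ := by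
  have hn : ∀ n, ‖c n * u ^ n‖ = ‖c n‖ := by intro n; rw [norm_mul, norm_pow, hu]; simp
  have hsn : Summable (fun n => ‖c n * u ^ n‖) := hc.congr fun n => (hn n).symm
  have hsm : Summable (fun n => c n * u ^ n) := hsn.of_norm
  have h1 := hsm.sum_add_tsum_nat_add K
  have h2 : ‖∑' n, c (n + K) * u ^ (n + K)‖ ≤ ∑' n, ‖c (n + K)‖ := by
    have h3 := norm_tsum_le_tsum_norm (f := fun n => c (n + K) * u ^ (n + K))
      ((summable_nat_add_iff K).2 hsn)
    rwa [tsum_congr (fun n => hn (n + K))] at h3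
  rw [eq_sub_of_add_eq h1]
  exact (norm_sub_le _ _).trans (add_le_add hM h2)

theorem aux_parseval (c : ℕ → ℂ) (hc : Summable (fun n => ‖c n‖)) (M : ℝ)
    (hM : ∀ u : ℂ, ‖u‖ = 1 → ‖∑' n, c n * u ^ n‖ ≤ M) (N : ℕ) :
    ∑ n ∈ Finset.range N, ‖c n‖ ^ 2 ≤ M ^ 2 := by
  have hM0 : 0 ≤ M := (norm_nonneg _).trans (hM 1 (by simp))
  let S : ℕ → C(AddCircle (2 * π), ℂ) := fun K =>
    ∑ n ∈ Finset.range K, c n • (fourier (n : ℤ) : C(AddCircle (2 * π), ℂ))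
  let T : ℕ → ℝ := fun K => ∑' n, ‖c (n + K)‖
  have hT : Filter.Tendsto T Filter.atTop (nhds 0) := tendsto_sum_nat_add (fun n => ‖c n‖)
  have hS : ∀ K, ‖S K‖ ≤ M + T K := by
    intro K
    have hTK : 0 ≤ T K := tsum_nonneg fun _ => norm_nonneg _
    refine (ContinuousMap.norm_le _ (by positivity)).2 fun t => ?_
    have hu : ‖(AddCircle.toCircle t : ℂ)‖ = 1 := Circle.norm_coe _
    obtain ⟨u, hu'⟩ : ∃ u : ℂ, u = (AddCircle.toCircle t : ℂ) := ⟨_, rfl⟩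
    rw [← hu'] at hu
    have e : S K t = ∑ n ∈ Finset.range K, c n * u ^ n := by
      simp only [S, ContinuousMap.coe_sum, Finset.sum_apply, ContinuousMap.coe_smul,
        Pi.smul_apply, smul_eq_mul]
      refine Finset.sum_congr rfl fun n _ => ?_
      rw [fourier_apply]
      simp [AddCircle.toCircle_nsmul, hu']
    rw [e]
    exact aux_part c hc M u hu (hM u hu) K
  have hL : ∀ K, ∑ n ∈ Finset.range K, ‖c n‖ ^ 2 ≤ ‖S K‖ ^ 2 := by
    intro K
    let L := ContinuousMap.toLp (E := ℂ) 2 (AddCircle.haarAddCircle (T := 2 * π)) ℂ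
    have hLS : L (S K) = ∑ n ∈ Finset.range K, c n • fourierLp (T := 2 * π) 2 (n : ℤ) := by
      simp only [S, map_sum, map_smul]; rfl
    have hle : ‖L (S K)‖ ≤ ‖S K‖ := by
      have h := ContinuousMap.toLp_norm_le (E := ℂ) (p := 2)
        (μ := AddCircle.haarAddCircle (T := 2 * π)) (𝕜 := ℂ)
      have h' : ‖L‖ ≤ 1 := by simpa [MeasureTheory.measureUnivNNReal] using h
      simpa using L.le_of_opNorm_le h' (S K)
    have ho : Orthonormal ℂ (fun n : ℕ => fourierLp (T := 2 * π) 2 (n : ℤ)) :=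
      (orthonormal_fourier (T := 2 * π)).comp (fun n : ℕ => (n : ℤ)) Nat.cast_injective
    have hin := ho.inner_sum c c (Finset.range K)
    rw [← hLS, inner_self_eq_norm_sq_to_K] at hin
    have : ∑ n ∈ Finset.range K, ‖c n‖ ^ 2 = ‖L (S K)‖ ^ 2 := by
      have h3 : ((‖L (S K)‖ ^ 2 : ℝ) : ℂ) = ((∑ n ∈ Finset.range K, ‖c n‖ ^ 2 : ℝ) : ℂ) := by
        push_cast
        refine hin.trans (Finset.sum_congr rfl fun n _ => ?_)
        rw [Complex.conj_mul']
      exact (Complex.ofReal_injective h3).symm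
    rw [this]
    gcongr
  have hlim : Filter.Tendsto (fun K => (M + T K) ^ 2) Filter.atTop (nhds (M ^ 2)) := by
    simpa using (hT.const_add M).pow 2
  refine ge_of_tendsto hlim ?_
  filter_upwards [Filter.eventually_ge_atTop N] with K hK
  calc ∑ n ∈ Finset.range N, ‖c n‖ ^ 2 ≤ ∑ n ∈ Finset.range K, ‖c n‖ ^ 2 :=
        Finset.sum_le_sum_of_subset_of_nonneg (by simpa using hK) (fun _ _ _ => by positivity)
    _ ≤ ‖S K‖ ^ 2 := hL K
    _ ≤ (M + T K) ^ 2 := by gcongr; exact hS K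

theorem aux_sq (f : ℂ → ℂ) (a : ℕ → ℂ)
    (hf : ∀ z ∈ ball (0 : ℂ) 1, HasSum (fun n : ℕ => a n * z ^ n) (f z))
    (hb : ∀ z ∈ ball (0 : ℂ) 1, (1 - ‖z‖ ^ 2) * ‖deriv f z‖ ≤ 1)
    (x : ℝ) (hx0 : 0 ≤ x) (hx : x < 1) (N : ℕ) :
    ∑ n ∈ Finset.range N, ((n : ℝ) + 1) ^ 2 * ‖a (n + 1)‖ ^ 2 * x ^ n ≤ 1 / (1 - x) ^ 2 := by
  set ρ := √x with hρ
  have hρ0 : 0 ≤ ρ := Real.sqrt_nonneg _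
  have hρx : ρ ^ 2 = x := Real.sq_sqrt hx0
  have hρ1 : ρ < 1 := by nlinarith
  have hnn : ∀ n : ℕ, ‖(n : ℂ) + 1‖ = (n : ℝ) + 1 := fun n => by
    have := Complex.norm_natCast (n + 1)
    push_cast at this; exact this
  have hcn : ∀ n : ℕ, ‖((n : ℂ) + 1) * a (n + 1) * (ρ : ℂ) ^ n‖
      = ((n : ℝ) + 1) * ‖a (n + 1)‖ * ρ ^ n := fun n => by
    rw [norm_mul, norm_mul, hnn, norm_pow, Complex.norm_of_nonneg hρ0]
  have h := aux_parseval (fun n => ((n : ℂ) + 1) * a (n + 1) * (ρ : ℂ) ^ n) (by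
    simp only [hcn]
    exact aux_summable a (fun z hz => (hf z hz).summable) ρ hρ0 hρ1) (1 / (1 - x)) (by
    intro u hu
    have hnz : ‖(ρ : ℂ) * u‖ = ρ := by rw [norm_mul, hu, Complex.norm_of_nonneg hρ0, mul_one]
    have hz : (ρ : ℂ) * u ∈ ball (0 : ℂ) 1 := by rw [mem_ball_zero_iff, hnz]; exact hρ1
    have h1 := hb _ hz
    rw [hnz, hρx, aux_deriv f a hf _ hz] at h1
    rw [le_div_iff₀ (by linarith), mul_comm]
    simpa only [mul_pow, mul_assoc] using h1) N
  simp only [hcn] at h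
  rw [div_pow, one_pow] at h
  refine le_trans (le_of_eq (Finset.sum_congr rfl fun n _ => ?_)) h
  rw [mul_pow, mul_pow, ← hρx, ← pow_mul, ← pow_mul, mul_comm 2 n]

theorem aux_weighted (f : ℂ → ℂ) (a : ℕ → ℂ)
    (hf : ∀ z ∈ ball (0 : ℂ) 1, HasSum (fun n : ℕ => a n * z ^ n) (f z))
    (hb : ∀ z ∈ ball (0 : ℂ) 1, (1 - ‖z‖ ^ 2) * ‖deriv f z‖ ≤ 1)
    (t : ℝ) (ht0 : 0 ≤ t) (ht : t < 1) (N : ℕ) :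
    ∑ n ∈ Finset.range N, ((n : ℝ) + 1) * ‖a (n + 1)‖ ^ 2 * t ^ (n + 1) ≤ t / (1 - t) := by
  let G : ℝ → ℝ := fun x => (1 - x)⁻¹ -
    ∑ n ∈ Finset.range N, ((n : ℝ) + 1) * ‖a (n + 1)‖ ^ 2 * x ^ (n + 1)
  have hG : ∀ x ∈ Set.Ico (0 : ℝ) 1, HasDerivAt G (1 / (1 - x) ^ 2 -
      ∑ n ∈ Finset.range N, ((n : ℝ) + 1) ^ 2 * ‖a (n + 1)‖ ^ 2 * x ^ n) x := by
    intro x hx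
    have hne : 1 - x ≠ 0 := by linarith [hx.2]
    refine HasDerivAt.sub ?_ ?_
    · refine (((hasDerivAt_id x).const_sub 1).inv hne).congr_deriv ?_
      simp
    · refine HasDerivAt.fun_sum fun n _ => ?_
      refine ((hasDerivAt_pow (n + 1) x).const_mul _).congr_deriv ?_
      push_cast
      ring
  have hmono : MonotoneOn G (Set.Ico 0 1) := by
    refine monotoneOn_of_deriv_nonneg (convex_Ico 0 1)
      (fun x hx => (hG x hx).continuousAt.continuousWithinAt)
      (fun x hx => (hG x (interior_subset hx)).differentiableAt.differentiableWithinAt) ?_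
    intro x hx
    have hx' := interior_subset hx
    rw [(hG x hx').deriv]
    exact sub_nonneg.2 (aux_sq f a hf hb x hx'.1 hx'.2 N)
  have := hmono (a := 0) (b := t) ⟨le_rfl, one_pos⟩ ⟨ht0, ht⟩ ht0
  simp [G] at this
  have h2 : t / (1 - t) = (1 - t)⁻¹ - 1 := by
    have hne : 1 - t ≠ 0 := by linarith
    field_simp; ring
  rw [h2]; linarith

theorem bloch_majorant_bound (f : ℂ → ℂ) (a : ℕ → ℂ)
    (hf : ∀ z ∈ ball (0 : ℂ) 1, HasSum (fun n : ℕ => a n * z ^ n) (f z))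
    (hb : ∀ z ∈ ball (0 : ℂ) 1, (1 - ‖z‖ ^ 2) * ‖deriv f z‖ ≤ 1)
    (s : ℝ) (hs0 : 0 < s) (hs1 : s < 1)
    (r : ℝ) (hr0 : 0 < r) (hr : r < 1) :
    ∑' n : ℕ, ‖a (n + 1)‖ * r ^ (n + 1) ≤
      Real.sqrt (r ^ (2 * (1 - s)) * Real.log (1 / (1 - r ^ (2 * s))) /
        (1 - r ^ (2 * (1 - s)))) := by
  refine Real.tsum_le_of_sum_range_le (fun n => by positivity) fun N => ?_
  refine Real.le_sqrt_of_sq_le ?_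
  set p := r ^ s with hp
  set q := r ^ (1 - s) with hq
  have hp0 : 0 < p := Real.rpow_pos_of_pos hr0 _
  have hq0 : 0 < q := Real.rpow_pos_of_pos hr0 _
  have hp1 : p < 1 := Real.rpow_lt_one hr0.le hr hs0
  have hq1 : q < 1 := Real.rpow_lt_one hr0.le hr (by linarith)
  have hpq : r = p * q := by rw [hp, hq, ← Real.rpow_add hr0]; simp
  have e1 : r ^ (2 * s) = p ^ 2 := by
    rw [hp, mul_comm, Real.rpow_mul hr0.le]; norm_cast
  have e2 : r ^ (2 * (1 - s)) = q ^ 2 := by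
    rw [hq, mul_comm, Real.rpow_mul hr0.le]; norm_cast
  rw [e1, e2]
  have hp2 : p ^ 2 < 1 := by nlinarith
  have hq2 : q ^ 2 < 1 := by nlinarith
  have hW := aux_weighted f a hf hb (q ^ 2) (by positivity) hq2 N
  have hlog : ∑ n ∈ Finset.range N, (p ^ 2) ^ (n + 1) / ((n : ℝ) + 1) ≤ Real.log (1 / (1 - p ^ 2)) := by
    have h := Real.hasSum_pow_div_log_of_abs_lt_one (x := p ^ 2)
      (by rw [abs_of_nonneg (by positivity)]; exact hp2)
    rw [one_div, Real.log_inv]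
    exact sum_le_hasSum _ (fun n _ => by positivity) h
  have hCS := Finset.sum_mul_sq_le_sq_mul_sq (Finset.range N)
    (fun n : ℕ => p ^ (n + 1) / √((n : ℝ) + 1))
    (fun n : ℕ => √((n : ℝ) + 1) * ‖a (n + 1)‖ * q ^ (n + 1))
  have hA : ∀ n : ℕ, p ^ (n + 1) / √((n : ℝ) + 1) * (√((n : ℝ) + 1) * ‖a (n + 1)‖ * q ^ (n + 1))
      = ‖a (n + 1)‖ * r ^ (n + 1) := fun n => by
    have : √((n : ℝ) + 1) ≠ 0 := by positivity
    rw [hpq, mul_pow]; field_simp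
  have hB : ∀ n : ℕ, (p ^ (n + 1) / √((n : ℝ) + 1)) ^ 2 = (p ^ 2) ^ (n + 1) / ((n : ℝ) + 1) :=
    fun n => by rw [div_pow, Real.sq_sqrt (by positivity), ← pow_mul, ← pow_mul, mul_comm 2]
  have hC : ∀ n : ℕ, (√((n : ℝ) + 1) * ‖a (n + 1)‖ * q ^ (n + 1)) ^ 2
      = ((n : ℝ) + 1) * ‖a (n + 1)‖ ^ 2 * (q ^ 2) ^ (n + 1) :=
    fun n => by
      rw [mul_pow, mul_pow, Real.sq_sqrt (by positivity), ← pow_mul, ← pow_mul, mul_comm 2]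
  simp only [hA, hB, hC] at hCS
  refine hCS.trans ?_
  have hlog0 : 0 ≤ Real.log (1 / (1 - p ^ 2)) :=
    (Finset.sum_nonneg fun n _ => by positivity).trans hlog
  refine (mul_le_mul hlog hW (Finset.sum_nonneg fun n _ => by positivity) hlog0).trans
    (le_of_eq ?_)
  ring
end

section
/- If f(z) = Σ a_n z^n is analytic on 𝔻 and |a_0| + sup_{|z|<1} (1-|z|^2)|f'(z)| ≤ 1, then Σ_{n≥0} |a_n| r^n ≤ 1 for all 0 ≤ r ≤ 0.563777. -/
open Metric

lemma bb_poly (P Q : Polynomial ℂ) (M : ℝ) (hM : ∀ z : ℂ, ‖z‖ = 1 → ‖P.eval z‖ ≤ M) (N K : ℕ)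
    (hK : Q.natDegree < K) :
    ∑ n ∈ Finset.range N, ‖(P * Q).coeff n‖ ^ 2
      ≤ M ^ 2 * ∑ n ∈ Finset.range K, ‖Q.coeff n‖ ^ 2 := by
  have h1 : ∑ n ∈ Finset.range N, ‖(P * Q).coeff n‖ ^ 2
      ≤ ∑ n ∈ (P * Q).support, ‖(P * Q).coeff n‖ ^ 2 := by
    rw [← Finset.sum_filter_add_sum_filter_not (Finset.range N) (fun n => n ∈ (P*Q).support)]
    have : ∑ n ∈ Finset.range N with ¬ n ∈ (P*Q).support, ‖(P * Q).coeff n‖ ^ 2 = 0 := by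
      apply Finset.sum_eq_zero
      intro n hn
      have := (Finset.mem_filter.1 hn).2
      rw [Polynomial.mem_support_iff, not_not] at this
      simp [this]
    rw [this, add_zero]
    apply Finset.sum_le_sum_of_subset_of_nonneg
    · intro n hn
      exact (Finset.mem_filter.1 hn).2
    · intros; positivity
  have h2 : ∑ n ∈ Finset.range K, ‖Q.coeff n‖ ^ 2 = ∑ n ∈ Q.support, ‖Q.coeff n‖ ^ 2 := by
    symm
    apply Finset.sum_subset
    · intro n hn
      rw [Finset.mem_range]
      exact lt_of_le_of_lt (Polynomial.le_natDegree_of_mem_supp n hn) hK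
    · intro n _ hn
      rw [Polynomial.mem_support_iff, not_not] at hn
      simp [hn]
  rw [h2]
  refine h1.trans ?_
  rw [Polynomial.sum_sq_norm_coeff_eq_circleAverage, Polynomial.sum_sq_norm_coeff_eq_circleAverage,
    ← smul_eq_mul (M ^ 2), ← Real.circleAverage_fun_smul]
  apply Real.circleAverage_mono
  · apply ContinuousOn.circleIntegrable'
    fun_prop
  · apply ContinuousOn.circleIntegrable'
    fun_prop
  · intro z hz
    have hz1 : ‖z‖ = 1 := by simpa using hz
    have := hM z hz1
    simp only [Polynomial.eval_mul, norm_mul, mul_pow, smul_eq_mul]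
    gcongr

/-- Polynomial truncations. -/
lemma bb_series (h : ℕ → ℂ) (hs : Summable fun n => ‖h n‖) (M : ℝ)
    (hM : ∀ z : ℂ, ‖z‖ = 1 → ‖∑' n, h n * z ^ n‖ ≤ M) (Q : Polynomial ℂ) (N K : ℕ)
    (hK : Q.natDegree < K) :
    ∃ N0, ∀ N' ≥ N0, ∀ P : Polynomial ℂ, P = ∑ n ∈ Finset.range N', Polynomial.monomial n (h n) → 
    (∀ n < N', P.coeff n = h n) ∧
    ∑ n ∈ Finset.range N, ‖(P * Q).coeff n‖ ^ 2
      ≤ (M + ∑' k, ‖h (k + N')‖) ^ 2 * ∑ n ∈ Finset.range K, ‖Q.coeff n‖ ^ 2 := by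
  refine ⟨0, fun N' _ P hP => ⟨?_, ?_⟩⟩
  · intro n hn
    rw [hP]
    simp [Polynomial.coeff_monomial, hn]
  · apply bb_poly _ _ _ _ _ _ hK
    intro z hz
    have hs1 : Summable fun n => ‖h n * z ^ n‖ := by simpa [hz] using hs
    have hs2 : Summable fun n => h n * z ^ n := hs1.of_norm
    have e : P.eval z = ∑' n, h n * z ^ n - ∑' k, h (k + N') * z ^ (k + N') := by
      rw [← hs2.sum_add_tsum_nat_add N', hP]
      simp [Polynomial.eval_finsetSum]
    rw [e]
    refine (norm_sub_le _ _).trans (add_le_add (hM z hz) ?_)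
    have hs3 := (summable_nat_add_iff N').2 hs1
    refine (norm_tsum_le_tsum_norm hs3).trans (le_of_eq ?_)
    simp [hz]

lemma bb_lim (h : ℕ → ℂ) (M c A : ℝ) (N0 : ℕ)
    (H : ∀ N' ≥ N0, A ≤ (M + ∑' k, ‖h (k + N')‖) ^ 2 * c) : A ≤ M ^ 2 * c := by
  have t : Filter.Tendsto (fun N' : ℕ => (M + ∑' k, ‖h (k + N')‖) ^ 2 * c) Filter.atTop
      (nhds ((M + 0) ^ 2 * c)) :=
    (((tendsto_const_nhds).add (tendsto_sum_nat_add (fun n => ‖h n‖))).pow 2).mul_const c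
  rw [add_zero] at t
  exact ge_of_tendsto t (Filter.eventually_atTop.2 ⟨N0, H⟩)

lemma bb_bessel (h : ℕ → ℂ) (hs : Summable fun n => ‖h n‖) (M : ℝ)
    (hM : ∀ z : ℂ, ‖z‖ = 1 → ‖∑' n, h n * z ^ n‖ ≤ M) (N : ℕ) :
    ∑ n ∈ Finset.range N, ‖h n‖ ^ 2 ≤ M ^ 2 := by
  obtain ⟨N0, H⟩ := bb_series h hs M hM 1 N 1 (by simp)
  have := bb_lim h M 1 (∑ n ∈ Finset.range N, ‖h n‖ ^ 2) (max N0 N) (fun N' hN' => by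
    obtain ⟨h1, h2⟩ := H N' ((le_max_left _ _).trans hN') _ rfl
    have h3 : N ≤ N' := (le_max_right _ _).trans hN'
    simp only [mul_one, Finset.sum_range_one, Polynomial.coeff_one_zero, norm_one, one_pow] at h2
    rw [mul_one]
    refine le_trans (le_of_eq ?_) h2
    apply Finset.sum_congr rfl
    intro n hn
    rw [h1 n (lt_of_lt_of_le (Finset.mem_range.1 hn) h3)])
  simpa using this

lemma bb_pick (h : ℕ → ℂ) (hs : Summable fun n => ‖h n‖) (M : ℝ)
    (hM : ∀ z : ℂ, ‖z‖ = 1 → ‖∑' n, h n * z ^ n‖ ≤ M) (l : ℂ) :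
    ‖h 0‖ ^ 2 + ‖h 1 + h 0 * l‖ ^ 2 ≤ M ^ 2 * (1 + ‖l‖ ^ 2) := by
  have hd : (1 + Polynomial.C l * Polynomial.X : Polynomial ℂ).natDegree < 2 := by
    have : (1 + Polynomial.C l * Polynomial.X : Polynomial ℂ).natDegree ≤ 1 := by
      compute_degree
    omega
  obtain ⟨N0, H⟩ := bb_series h hs M hM (1 + Polynomial.C l * Polynomial.X) 2 2 hd
  apply bb_lim h M _ _ (max N0 2)
  intro N' hN'
  obtain ⟨h1, h2⟩ := H N' ((le_max_left _ _).trans hN') _ rfl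
  have h3 : 2 ≤ N' := (le_max_right _ _).trans hN'
  have e0 := h1 0 (by omega)
  have e1 := h1 1 (by omega)
  generalize (∑ n ∈ Finset.range N', Polynomial.monomial n (h n)) = P at *
  rw [mul_add, mul_one, ← mul_assoc] at h2
  simp only [Finset.sum_range_succ, Finset.sum_range_zero, zero_add, Polynomial.coeff_add,
    Polynomial.coeff_mul_X_zero, Polynomial.coeff_mul_X, Polynomial.coeff_mul_C, e0, e1,
    Polynomial.coeff_one, Polynomial.coeff_C] at h2
  simpa using h2

/-- Partial sums of the majorant. -/
lemma bb_dilog (N : ℕ) :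
    ∑ n ∈ Finset.range N, (0.8137 : ℝ) ^ n / ((n : ℝ) + 1) ^ 2 ≤ 1.358 := by
  have key : ∀ k : ℕ, ∑ n ∈ Finset.range (10 + k), (0.8137 : ℝ) ^ n / ((n : ℝ) + 1) ^ 2
      ≤ ∑ n ∈ Finset.range 10, (0.8137 : ℝ) ^ n / ((n : ℝ) + 1) ^ 2
        + ((0.8137 : ℝ) ^ 10 - 0.8137 ^ (10 + k)) / (0.1863 * 121) := by
    intro k
    induction k with
    | zero => simp
    | succ k ih =>
      rw [← add_assoc, Finset.sum_range_succ]
      have h1 : (0.8137 : ℝ) ^ (10 + k) / (((10 + k : ℕ) : ℝ) + 1) ^ 2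
          ≤ (0.8137 : ℝ) ^ (10 + k) / 121 := by
        apply div_le_div_of_nonneg_left (by positivity) (by norm_num)
        push_cast
        have : (0 : ℝ) ≤ k := Nat.cast_nonneg k
        nlinarith
      rw [pow_succ (0.8137 : ℝ) (10 + k)]
      generalize (0.8137 : ℝ) ^ (10 + k) = w at *
      have h2 : ((0.8137 : ℝ) ^ 10 - w * 0.8137) / (0.1863 * 121)
          = ((0.8137 : ℝ) ^ 10 - w) / (0.1863 * 121) + w / 121 := by
        field_simp
        ring
      rw [h2]
      linarith
  have hm : ∑ n ∈ Finset.range N, (0.8137 : ℝ) ^ n / ((n : ℝ) + 1) ^ 2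
      ≤ ∑ n ∈ Finset.range (10 + N), (0.8137 : ℝ) ^ n / ((n : ℝ) + 1) ^ 2 := by
    apply Finset.sum_le_sum_of_subset_of_nonneg
    · intro n hn
      rw [Finset.mem_range] at *
      omega
    · intros; positivity
  refine hm.trans ((key N).trans ?_)
  have h0 : (0 : ℝ) ≤ 0.8137 ^ (10 + N) := by positivity
  have h1 : ((0.8137 : ℝ) ^ 10 - 0.8137 ^ (10 + N)) / (0.1863 * 121)
      ≤ (0.8137 : ℝ) ^ 10 / (0.1863 * 121) := by
    gcongr
    linarith
  refine (add_le_add_right h1 _).trans ?_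
  norm_num [Finset.sum_range_succ]

lemma bb_term (x : ℝ) (n : ℕ) :
    x * ((0.563777 : ℝ) ^ (n + 1) / ((n : ℝ) + 1)) ≤
      0.13 * (x ^ 2 * (25 / 64) ^ n)
        + 0.31785 / 0.52 * ((0.8137 : ℝ) ^ n / ((n : ℝ) + 1) ^ 2) := by
  have hq : (0.563777 ^ 2 : ℝ) ^ n ≤ (25 / 64) ^ n * 0.8137 ^ n := by
    rw [← mul_pow]
    apply pow_le_pow_left₀ (by norm_num)
    norm_num
  set s : ℝ := (5 / 8) ^ n with hs
  have hs0 : 0 < s := by positivity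
  have hs2 : (25 / 64 : ℝ) ^ n = s ^ 2 := by
    rw [hs, ← pow_mul, mul_comm, pow_mul]; norm_num
  set R : ℝ := (0.563777) ^ n with hR
  have hR2 : (0.563777 ^ 2 : ℝ) ^ n = R ^ 2 := by
    rw [hR, ← pow_mul, ← pow_mul, mul_comm]
  rw [hR2, hs2] at hq
  rw [hs2]
  have hn : (0 : ℝ) < (n : ℝ) + 1 := by positivity
  set Y : ℝ := R * 0.563777 / (((n : ℝ) + 1) * s) with hY
  have e1 : x * ((0.563777 : ℝ) ^ (n + 1) / ((n : ℝ) + 1)) = (x * s) * Y := by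
    rw [hY, pow_succ, ← hR]; field_simp
  have e2 : Y ^ 2 ≤ 0.31785 * ((0.8137 : ℝ) ^ n / ((n : ℝ) + 1) ^ 2) := by
    rw [hY, div_pow, ← mul_div_assoc, div_le_div_iff₀ (by positivity) (by positivity)]
    have : (R * 0.563777) ^ 2 ≤ 0.31785 * 0.8137 ^ n * s ^ 2 := by nlinarith [sq_nonneg R]
    calc (R * 0.563777) ^ 2 * ((n : ℝ) + 1) ^ 2
        ≤ (0.31785 * 0.8137 ^ n * s ^ 2) * ((n : ℝ) + 1) ^ 2 := by gcongr
      _ = _ := by ring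
  rw [e1]
  have := sq_nonneg (0.26 * (x * s) - Y)
  nlinarith

lemma bb_num (x : ℕ → ℝ) (hx : ∀ n, 0 ≤ x n) (h0 : x 0 ≤ 1)
    (hA : ∀ N, ∑ n ∈ Finset.range N, x n ^ 2 * (25 / 64) ^ n ≤ (64 / 39) ^ 2)
    (hB : 0.97 ≤ x 0 → x 1 ≤ 0.9) (N : ℕ) :
    ∑ n ∈ Finset.range N, x n * ((0.563777 : ℝ) ^ (n + 1) / ((n : ℝ) + 1)) ≤ 1 := by
  have hm : ∑ n ∈ Finset.range N, x n * ((0.563777 : ℝ) ^ (n + 1) / ((n : ℝ) + 1))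
      ≤ ∑ n ∈ Finset.range (N + 1 + 1), x n * ((0.563777 : ℝ) ^ (n + 1) / ((n : ℝ) + 1)) := by
    apply Finset.sum_le_sum_of_subset_of_nonneg
    · intro n hn
      rw [Finset.mem_range] at *
      omega
    · intro n _ _
      have := hx n
      positivity
  refine hm.trans ?_
  have A := hA (N + 1 + 1)
  have D := bb_dilog (N + 1 + 1)
  have T : ∑ n ∈ Finset.range N, x (n+1+1) * ((0.563777 : ℝ) ^ (n+1+1 + 1) / (((n+1+1 : ℕ) : ℝ) + 1))
    ≤ ∑ n ∈ Finset.range N, (0.13 * (x (n+1+1) ^ 2 * (25 / 64) ^ (n+1+1))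
        + 0.31785 / 0.52 * ((0.8137 : ℝ) ^ (n+1+1) / (((n+1+1 : ℕ) : ℝ) + 1) ^ 2)) :=
    Finset.sum_le_sum fun n _ => bb_term _ _
  rw [Finset.sum_add_distrib, ← Finset.mul_sum, ← Finset.mul_sum] at T
  have T1 := bb_term (x 1) 1
  rw [Finset.sum_range_succ', Finset.sum_range_succ'] at A D ⊢
  norm_num at A D T T1 ⊢
  have p0 := hx 0
  have p1 := hx 1
  by_cases hc : 0.97 ≤ x 0
  · have hB1 := hB hc
    norm_num at hB1 hc
    nlinarith
  · norm_num at hc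
    nlinarith

lemma bb_deriv (f : ℂ → ℂ) (a : ℕ → ℂ)
    (hf : ∀ z ∈ ball (0 : ℂ) 1, HasSum (fun n : ℕ => a n * z ^ n) (f z)) (z : ℂ) (hz : ‖z‖ < 1) :
    HasSum (fun n : ℕ => ((n : ℂ) + 1) * a (n + 1) * z ^ n) (deriv f z) := by
  obtain ⟨ρ, h1, h2⟩ := exists_between hz
  have hρ : 0 ≤ ρ := (norm_nonneg z).trans h1.le
  have hs : Summable fun n => ‖a n‖ * ρ ^ n := by
    have := (hf (ρ : ℂ) (by simpa [abs_of_nonneg hρ] using h2)).summable.norm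
    simpa [abs_of_nonneg hρ] using this
  have key := Complex.hasSum_deriv_of_summable_norm (F := fun n w => a n * w ^ n)
    (U := ball (0 : ℂ) ρ) (z := z) hs (fun i => by fun_prop) isOpen_ball
    (fun i w hw => by
      have hw : ‖w‖ < ρ := by simpa using hw
      rw [norm_mul, norm_pow]
      gcongr) (by simpa using h1)
  have e : deriv (fun w : ℂ => ∑' i : ℕ, a i * w ^ i) z = deriv f z := by
    apply Filter.EventuallyEq.deriv_eq
    filter_upwards [isOpen_ball.mem_nhds (show z ∈ ball (0 : ℂ) 1 by simpa using hz)] with w hw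
    exact (hf w hw).tsum_eq
  rw [e] at key
  rw [← hasSum_nat_add_iff' 1] at key
  have e3 : (fun n : ℕ => ((n : ℂ) + 1) * a (n + 1) * z ^ n)
      = fun n : ℕ => deriv (fun w => a (n + 1) * w ^ (n + 1)) z := by
    funext n
    simp
    ring
  have e4 : ∑ i ∈ Finset.range 1, deriv (fun w => a i * w ^ i) z = 0 := by simp
  rw [e4, sub_zero] at key
  rw [e3]
  exact key

lemma bb_coef (b : ℕ → ℂ) (g : ℂ → ℂ)
    (hg : ∀ z : ℂ, ‖z‖ < 1 → HasSum (fun n : ℕ => b n * z ^ n) (g z))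
    (hb : ∀ z : ℂ, ‖z‖ < 1 → (1 - ‖z‖ ^ 2) * ‖g z‖ ≤ 1) (N : ℕ) :
    ∑ n ∈ Finset.range N, ‖b n‖ * ((0.563777 : ℝ) ^ (n + 1) / ((n : ℝ) + 1)) ≤ 1 := by
  have hS : ∀ ρ : ℝ, 0 ≤ ρ → ρ < 1 → Summable fun n => ‖b n * (ρ : ℂ) ^ n‖ := fun ρ h0 h1 =>
    (hg (ρ : ℂ) (by simpa [abs_of_nonneg h0] using h1)).summable.norm
  have hB : ∀ ρ : ℝ, 0 ≤ ρ → ρ < 1 → ∀ z : ℂ, ‖z‖ = 1 →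
      ‖∑' n, b n * (ρ : ℂ) ^ n * z ^ n‖ ≤ 1 / (1 - ρ ^ 2) := by
    intro ρ h0 h1 z hz
    have hn : ‖(ρ : ℂ) * z‖ = ρ := by simp [hz, abs_of_nonneg h0]
    have e : ∑' n, b n * (ρ : ℂ) ^ n * z ^ n = g (ρ * z) := by
      rw [← (hg (ρ * z) (by rw [hn]; exact h1)).tsum_eq]
      simp only [mul_pow, mul_assoc]
    have := hb (ρ * z) (by rw [hn]; exact h1)
    rw [hn] at this
    rw [e, le_div_iff₀ (by nlinarith)]
    linarith
  have hg0 : g 0 = b 0 := by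
    have h := hg 0 (by simp)
    have h' := hasSum_single (f := fun n : ℕ => b n * (0 : ℂ) ^ n) 0 (fun n hn => by simp [hn])
    simpa using h.unique h'
  apply bb_num (fun n => ‖b n‖) (fun n => norm_nonneg _)
  · have := hb 0 (by simp)
    simpa [hg0] using this
  · intro N
    have := bb_bessel _ (hS (5 / 8) (by norm_num) (by norm_num)) _
      (hB (5 / 8) (by norm_num) (by norm_num)) N
    refine le_trans (le_of_eq ?_) (this.trans (by norm_num))
    apply Finset.sum_congr rfl
    intro n _
    rw [norm_mul, norm_pow, mul_pow, ← pow_mul, mul_comm n 2, pow_mul]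
    congr 2
    rw [Complex.norm_real]
    norm_num
  · intro h97
    have := bb_pick _ (hS (1 / 3) (by norm_num) (by norm_num)) _
      (hB (1 / 3) (by norm_num) (by norm_num))
      ((256 / 81 * (1 / 3) : ℝ) * (starRingEnd ℂ (b 0)) * b 1)
    have e : b 1 * ((1 / 3 : ℝ) : ℂ) ^ 1 + b 0 * ((1 / 3 : ℝ) : ℂ) ^ 0 *
        ((256 / 81 * (1 / 3) : ℝ) * (starRingEnd ℂ (b 0)) * b 1)
        = b 1 * ((1 / 3 * (1 + 256 / 81 * ‖b 0‖ ^ 2) : ℝ) : ℂ) := by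
      have := Complex.mul_conj' (b 0)
      push_cast
      linear_combination (256 / 81 * (1 / 3) * b 1) * this
    rw [e] at this
    simp only [norm_mul, Complex.norm_real, Complex.norm_conj, pow_zero, mul_one,
      Real.norm_eq_abs] at this
    rw [abs_of_nonneg (by positivity : (0 : ℝ) ≤ 1 / 3),
      abs_of_nonneg (by positivity : (0 : ℝ) ≤ 256 / 81),
      abs_of_nonneg (by positivity : (0 : ℝ) ≤ 1 + 256 / 81 * ‖b 0‖ ^ 2)] at this
    show ‖b 1‖ ≤ 0.9
    change 0.97 ≤ ‖b 0‖ at h97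
    have q0 := norm_nonneg (b 1)
    generalize ‖b 0‖ = p at *
    generalize ‖b 1‖ = q at *
    have hp : 0.94 ≤ p ^ 2 := by nlinarith
    generalize hP : p ^ 2 = P at *
    by_contra hq
    push Not at hq
    have hq2 : 0.81 ≤ q ^ 2 := by norm_num at hq ⊢; nlinarith
    have hk : 3.8 ≤ (256 / 81 * P - 1) ^ 2 := by
      norm_num at hp ⊢
      nlinarith
    have h9 : 0.81 * 3.8 ≤ q ^ 2 * (256 / 81 * P - 1) ^ 2 :=
      mul_le_mul hq2 hk (by norm_num) (by positivity)
    have e5 : (256 / 81 * (1 / 3) * p * q) ^ 2 = (256 / 81 * (1 / 3)) ^ 2 * P * q ^ 2 := by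
      rw [← hP]; ring
    rw [e5] at this
    ring_nf at this h9 hp
    linarith

theorem bohr_radius_bloch_lower (f : ℂ → ℂ) (a : ℕ → ℂ)
    (hf : ∀ z ∈ ball (0 : ℂ) 1, HasSum (fun n : ℕ => a n * z ^ n) (f z))
    (hb : ∀ z ∈ ball (0 : ℂ) 1, ‖a 0‖ + (1 - ‖z‖ ^ 2) * ‖deriv f z‖ ≤ 1)
    (r : ℝ) (hr0 : 0 ≤ r) (hr : r ≤ 0.563777) :
    ∑' n : ℕ, ‖a n‖ * r ^ n ≤ 1 := by
  have hd := bb_deriv f a hf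
  set L : ℝ := 1 - ‖a 0‖ with hL
  have hb' : ∀ z : ℂ, ‖z‖ < 1 → (1 - ‖z‖ ^ 2) * ‖deriv f z‖ ≤ L := fun z hz => by
    have := hb z (by simpa using hz)
    linarith
  have hL0 : 0 ≤ L := by
    have := hb' 0 (by simp)
    have h2 := norm_nonneg (deriv f 0)
    simp at this
    linarith
  have main : ∀ N, ∑ n ∈ Finset.range N,
      ‖((n : ℂ) + 1) * a (n + 1)‖ * ((0.563777 : ℝ) ^ (n + 1) / ((n : ℝ) + 1)) ≤ L := by
    intro N
    have step : ∀ l : ℝ, L < l → ∑ n ∈ Finset.range N,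
      ‖((n : ℂ) + 1) * a (n + 1)‖ * ((0.563777 : ℝ) ^ (n + 1) / ((n : ℝ) + 1)) ≤ l := by
      intro l hl
      have hl0 : 0 < l := hL0.trans_lt hl
      have := bb_coef (fun n => (((n : ℂ) + 1) * a (n + 1)) / (l : ℂ)) (fun z => deriv f z / l)
        (fun z hz => by
          have := (hd z hz).div_const (l : ℂ)
          simpa only [div_mul_eq_mul_div] using this)
        (fun z hz => by
          rw [norm_div, Complex.norm_real, Real.norm_eq_abs, abs_of_pos hl0, ← mul_div_assoc,
            div_le_one hl0]
          exact (hb' z hz).trans hl.le) N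
      simp only [norm_div, Complex.norm_real, Real.norm_eq_abs, abs_of_pos hl0] at this
      simp only [div_mul_eq_mul_div] at this
      rw [← Finset.sum_div, div_le_one hl0] at this
      exact this
    exact le_of_forall_gt_imp_ge_of_dense step
  have fin : ∀ N, ∑ n ∈ Finset.range N, ‖a n‖ * r ^ n ≤ 1 := by
    intro N
    have hm : ∑ n ∈ Finset.range N, ‖a n‖ * r ^ n ≤ ∑ n ∈ Finset.range (N + 1), ‖a n‖ * r ^ n := by
      rw [Finset.sum_range_succ]
      have : 0 ≤ ‖a N‖ * r ^ N := by positivity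
      linarith
    refine hm.trans ?_
    rw [Finset.sum_range_succ']
    have : ∑ n ∈ Finset.range N, ‖a (n + 1)‖ * r ^ (n + 1) ≤ L := by
      refine le_trans (Finset.sum_le_sum fun n _ => ?_) (main N)
      have e : ‖((n : ℂ) + 1) * a (n + 1)‖ = ((n : ℝ) + 1) * ‖a (n + 1)‖ := by
        rw [norm_mul]
        congr 1
        exact_mod_cast Complex.norm_natCast (n + 1)
      rw [e]
      have e2 : ((n : ℝ) + 1) * ‖a (n + 1)‖ * ((0.563777 : ℝ) ^ (n + 1) / ((n : ℝ) + 1))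
          = ‖a (n + 1)‖ * 0.563777 ^ (n + 1) := by
        field_simp
      rw [e2]
      gcongr
    simp only [pow_zero, mul_one]
    linarith
  exact Real.tsum_le_of_sum_range_le (fun n => by positivity) fin
end
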